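/- arXiv:2402.11918 — 2 statements merged into one kernel-verified Lean document; each statement's English description precedes it below -/
import Mathlib

section
/- For every feasible set X ∈ F_H, we have |S_∅| ≤ |X|; that is, the set of critical hospitals S_∅ has minimum cardinality among all subsets of H whose deletion yields an instance admitting a super-stable matching. -/
open Set

/-- `incid v e` : edge `e` is incident to vertex `v`. -/
def incid {V : Type*} (v : V) (e : V × V) : Prop := e.1 = v ∨ e.2 = v

/-- An instance of the super-stable matching problem with ties: a finite simple
bipartite graph whose vertices are partitioned into doctors `Dset` and
hospitals `Hset`, each edge `(d,h)` joining a doctor to a hospital, together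
with, for each vertex `v`, a transitive and total preference relation
`pref v` (possibly with ties) on the edges incident to `v`. -/
structure SMInstance (V : Type*) where
  Dset : Set V
  Hset : Set V
  E : Set (V × V)
  pref : V → (V × V) → (V × V) → Prop
  disj : Disjoint Dset Hset
  cover : Dset ∪ Hset = Set.univ
  edge_mem : ∀ e ∈ E, e.1 ∈ Dset ∧ e.2 ∈ Hset
  pref_total : ∀ v, ∀ e ∈ E, ∀ f ∈ E, incid v e → incid v f →
    pref v e f ∨ pref v f e
  pref_trans : ∀ v, ∀ e ∈ E, ∀ f ∈ E, ∀ g ∈ E,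
    incid v e → incid v f → incid v g →
    pref v e f → pref v f g → pref v e g

namespace SMInstance

variable {V : Type*} (I : SMInstance V)

/-- Strict preference `e ≻_v f`. -/
def sprefer (v : V) (e f : V × V) : Prop := I.pref v e f ∧ ¬ I.pref v f e

/-- `Ch_d(F)` for a doctor `d`. -/
def Chd (d : V) (F : Set (V × V)) : Set (V × V) :=
  {e ∈ F | incid d e ∧ ∀ f ∈ F, incid d f → I.pref d e f}

/-- `Ch_h(F)` for a hospital `h`. -/
def Chh (h : V) (F : Set (V × V)) : Set (V × V) :=
  {e ∈ F | incid h e ∧ ∀ f ∈ F, incid h f → f ≠ e → I.sprefer h e f}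

/-- `Ch_D(F) = ⋃_{d ∈ D} Ch_d(F)`. -/
def ChD (F : Set (V × V)) : Set (V × V) := ⋃ d ∈ I.Dset, I.Chd d F

/-- `Ch_H(F) = ⋃_{h ∈ H} Ch_h(F)`. -/
def ChH (F : Set (V × V)) : Set (V × V) := ⋃ h ∈ I.Hset, I.Chh h F

/-- `D[F]` : the set of doctors incident to some edge of `F`. -/
def docs (F : Set (V × V)) : Set V := {d ∈ I.Dset | ∃ e ∈ F, incid d e}

/-- The sequence `R_{X,t}` of the preprocessing algorithm:
`R_{X,0} = E(X)`, and `R_{X,t+1} = R_{X,t} ∪ (P_{X,t+1} \ Q_{X,t+1})` where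
`P_{X,t+1} = Ch_D(E \ R_{X,t})` and
`Q_{X,t+1} = Ch_H(P_{X,t+1} ∪ R_{X,t}) ∩ P_{X,t+1}`. -/
def R (X : Set V) : ℕ → Set (V × V)
  | 0 => {e ∈ I.E | e.2 ∈ X}
  | t + 1 =>
      R X t ∪
        (I.ChD (I.E \ R X t) \
          (I.ChH (I.ChD (I.E \ R X t) ∪ R X t) ∩ I.ChD (I.E \ R X t)))

/-- `k_X` : the least `t ≥ 1` with `R_{X,t} = R_{X,t-1}`. -/
noncomputable def kX (X : Set V) : ℕ :=
  sInf {t : ℕ | 1 ≤ t ∧ I.R X t = I.R X (t - 1)}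

/-- `B_X = R_{X,k_X}`. -/
noncomputable def B (X : Set V) : Set (V × V) := I.R X (I.kX X)

/-- A matching in the induced subgraph `G⟨V \ X⟩`. -/
def isMatching (X : Set V) (μ : Set (V × V)) : Prop :=
  μ ⊆ I.E ∧ (∀ e ∈ μ, e.1 ∉ X ∧ e.2 ∉ X) ∧
    ∀ v, ∀ e ∈ μ, ∀ f ∈ μ, incid v e → incid v f → e = f

/-- `e = (d,h)` blocks the matching `μ` of `G⟨V \ X⟩`:
`e ∈ E⟨V \ X⟩ \ μ`, `e ≿_d μ(d)` and `e ≿_h μ(h)`. -/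
def blocks (X : Set V) (μ : Set (V × V)) (e : V × V) : Prop :=
  e ∈ I.E ∧ e.1 ∉ X ∧ e.2 ∉ X ∧ e ∉ μ ∧
    (∀ f ∈ μ, incid e.1 f → I.pref e.1 e f) ∧
    (∀ f ∈ μ, incid e.2 f → I.pref e.2 e f)

/-- `μ` is a super-stable matching in `G⟨V \ X⟩`. -/
def superStable (X : Set V) (μ : Set (V × V)) : Prop :=
  I.isMatching X μ ∧ ∀ e, ¬ I.blocks X μ e

/-- `X` is feasible: `G⟨V \ X⟩` admits a super-stable matching. -/
def feasible (X : Set V) : Prop := ∃ μ, I.superStable X μ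

/-- `h` is a critical hospital with respect to `(B_X, μ_X)`:
`μ_X(h) = ∅` and at least one of `B_X(h) ≠ ∅` and
`Ch_D(E \ B_X) ∩ E(h) ≠ ∅` holds. -/
def critical (X : Set V) (μ : Set (V × V)) (h : V) : Prop :=
  h ∈ I.Hset ∧ (∀ e ∈ μ, ¬ incid h e) ∧
    ((∃ e ∈ I.B X, incid h e) ∨ ∃ e ∈ I.ChD (I.E \ I.B X), incid h e)

end SMInstance

namespace SMInstance

variable {V : Type*} (I : SMInstance V)

theorem fst_eq_of_incid {d : V} {e : V × V} (he : e ∈ I.E) (hd : d ∈ I.Dset)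
    (h : incid d e) : e.1 = d := by
  rcases h with h | h
  · exact h
  · exact absurd (h ▸ (I.edge_mem e he).2) (I.disj.notMem_of_mem_left hd)

theorem snd_eq_of_incid {h : V} {e : V × V} (he : e ∈ I.E) (hh : h ∈ I.Hset)
    (hi : incid h e) : e.2 = h := by
  rcases hi with hi | hi
  · exact absurd hh (I.disj.notMem_of_mem_left (hi ▸ (I.edge_mem e he).1))
  · exact hi

/-- The doctor of `e` weakly prefers `e` to its partner in `σ`. -/
def WeaklyBeats (σ : Set (V × V)) (e : V × V) : Prop :=
  e ∈ I.E ∧ ∀ g ∈ σ, incid e.1 g → I.pref e.1 e g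

variable {I}

theorem weaklyBeats_of_mem_ChD {σ F : Set (V × V)} (hσ : σ ⊆ I.E \ F) {e : V × V}
    (he : e ∈ I.ChD (I.E \ F)) : I.WeaklyBeats σ e := by
  simp only [ChD, Set.mem_iUnion] at he
  obtain ⟨d, hd, heF, hde, hbest⟩ := he
  obtain rfl := I.fst_eq_of_incid heF.1 hd hde
  exact ⟨heF.1, fun g hg hi => hbest g (hσ hg) hi⟩

/-- If `σ` is super-stable and `f ∉ σ` is at least as good as the partner in `σ` for its doctor,
then its hospital, unless deleted, is matched in `σ` along an edge it strictly prefers to `f`. -/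
theorem exists_mem_incid_of_weaklyBeats {X : Set V} {σ : Set (V × V)} (hX : X ⊆ I.Hset)
    (hσ : I.superStable X σ) {f : V × V} (hf : I.WeaklyBeats σ f) (hfX : f.2 ∉ X)
    (hfσ : f ∉ σ) : ∃ g ∈ σ, incid f.2 g ∧ ¬ I.pref f.2 f g := by
  by_contra! hcon
  exact hσ.2 f ⟨hf.1, fun h => I.disj.notMem_of_mem_left (I.edge_mem f hf.1).1 (hX h), hfX, hfσ,
    hf.2, hcon⟩

/-- A super-stable matching avoids all edges removed by the preprocessing algorithm, and doctors
weakly prefer the removed edges to their partners. -/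
theorem R_empty_spec {X : Set V} {σ : Set (V × V)} (hX : X ⊆ I.Hset)
    (hσ : I.superStable X σ) (t : ℕ) :
    σ ⊆ I.E \ I.R ∅ t ∧ ∀ f ∈ I.R ∅ t, I.WeaklyBeats σ f := by
  induction t with
  | zero => exact ⟨fun e he => ⟨hσ.1.1 he, fun h => h.2⟩, fun f hf => hf.2.elim⟩
  | succ t ih =>
    obtain ⟨hsub, hR⟩ := ih
    refine ⟨fun e he => ⟨hσ.1.1 he, ?_⟩, ?_⟩
    · rintro (heR | ⟨heP, heQ⟩)
      · exact (hsub he).2 heR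
      · have heE := hσ.1.1 he
        have heH := (I.edge_mem e heE).2
        apply heQ
        refine ⟨?_, heP⟩
        simp only [ChH, Set.mem_iUnion]
        refine ⟨e.2, heH, Or.inl heP, Or.inr rfl, fun f hf hi hne => ?_⟩
        have hW : I.WeaklyBeats σ f :=
          hf.elim (weaklyBeats_of_mem_ChD hsub) (hR f)
        have hfe := I.snd_eq_of_incid hW.1 heH hi
        have hfσ : f ∉ σ := fun h => hne (hσ.1.2.2 _ f h e he hi (Or.inr rfl))
        obtain ⟨g, hg, hgi, hnot⟩ := exists_mem_incid_of_weaklyBeats hX hσ hW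
          (hfe ▸ (hσ.1.2.1 e he).2) hfσ
        rw [hfe] at hgi hnot
        obtain rfl := hσ.1.2.2 _ g hg e he hgi (Or.inr rfl)
        exact ⟨(I.pref_total g.2 g heE f hW.1 (Or.inr rfl) hi).resolve_right hnot, hnot⟩
    · rintro f (hf | hf)
      · exact hR f hf
      · exact weaklyBeats_of_mem_ChD hsub hf.1

theorem isMatching.injOn_fst {X : Set V} {μ : Set (V × V)} (h : I.isMatching X μ) :
    Set.InjOn Prod.fst μ :=
  fun e he f hf hef => h.2.2 e.1 e he f hf (Or.inl rfl) (Or.inl hef.symm)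

theorem isMatching.injOn_snd {X : Set V} {μ : Set (V × V)} (h : I.isMatching X μ) :
    Set.InjOn Prod.snd μ :=
  fun e he f hf hef => h.2.2 e.2 e he f hf (Or.inr rfl) (Or.inr hef.symm)

end SMInstance

/-- For every feasible set `X ∈ F_H` we have `|S_∅| ≤ |X|`: the set of
critical hospitals has minimum cardinality among all subsets of `H` whose
deletion yields an instance admitting a super-stable matching. -/
theorem statement10 {V : Type*} [Fintype V] (I : SMInstance V)
    (μ0 : Set (V × V)) (hμ0 : I.isMatching (∅ : Set V) μ0)
    (hμ0Ch : μ0 ⊆ I.ChD (I.E \ I.B (∅ : Set V)))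
    (hμ0cov : ∀ d ∈ I.docs (I.E \ I.B (∅ : Set V)), ∃ e ∈ μ0, incid d e)
    (X : Set V) (hX : X ⊆ I.Hset) (hfeas : I.feasible X) :
    {h | I.critical (∅ : Set V) μ0 h}.ncard ≤ X.ncard := by
  obtain ⟨σ, hσ⟩ := hfeas
  obtain ⟨hσB, hB⟩ := SMInstance.R_empty_spec hX hσ (I.kX ∅)
  change σ ⊆ I.E \ I.B ∅ at hσB
  set T : Set V := {h | h ∈ I.Hset ∧
    ((∃ e ∈ I.B ∅, incid h e) ∨ ∃ e ∈ I.ChD (I.E \ I.B ∅), incid h e)}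
  set S : Set V := {h | I.critical ∅ μ0 h}
  have hdisj : Disjoint S (Prod.snd '' μ0) := by
    rw [Set.disjoint_left]
    rintro _ hS ⟨e, he, rfl⟩
    exact hS.2.1 e he (Or.inr rfl)
  have hST : S ∪ Prod.snd '' μ0 ⊆ T := by
    rintro h (hS | ⟨e, he, rfl⟩)
    · exact ⟨hS.1, hS.2.2⟩
    · exact ⟨(I.edge_mem e (hμ0.1 he)).2, Or.inr ⟨e, hμ0Ch he, Or.inr rfl⟩⟩
  have hTX : T ⊆ X ∪ Prod.snd '' σ := by
    rintro h ⟨hH, hT⟩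
    by_cases hhX : h ∈ X
    · exact Or.inl hhX
    right
    obtain ⟨f, hW, hi⟩ : ∃ f, I.WeaklyBeats σ f ∧ incid h f := by
      rcases hT with ⟨f, hf, hi⟩ | ⟨f, hf, hi⟩
      · exact ⟨f, hB f hf, hi⟩
      · exact ⟨f, SMInstance.weaklyBeats_of_mem_ChD hσB hf, hi⟩
    obtain rfl := I.snd_eq_of_incid hW.1 hH hi
    by_cases hfσ : f ∈ σ
    · exact ⟨f, hfσ, rfl⟩
    · obtain ⟨g, hg, hgi, -⟩ := SMInstance.exists_mem_incid_of_weaklyBeats hX hσ hW hhX hfσ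
      exact ⟨g, hg, I.snd_eq_of_incid (hσ.1.1 hg) hH hgi⟩
  have hfst : Prod.fst '' σ ⊆ Prod.fst '' μ0 := by
    rintro _ ⟨e, he, rfl⟩
    have hD := (I.edge_mem e (hσ.1.1 he)).1
    obtain ⟨g, hg, hgi⟩ := hμ0cov e.1 ⟨hD, e, hσB he, Or.inl rfl⟩
    exact ⟨g, hg, I.fst_eq_of_incid (hμ0.1 hg) hD hgi⟩
  have h1 := Set.ncard_le_ncard hST
  rw [Set.ncard_union_eq hdisj, hμ0.injOn_snd.ncard_image] at h1
  have h2 := (Set.ncard_le_ncard hTX).trans (Set.ncard_union_le _ _)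
  rw [hσ.1.injOn_snd.ncard_image] at h2
  have h3 := Set.ncard_le_ncard hfst
  rw [hσ.1.injOn_fst.ncard_image, hμ0.injOn_fst.ncard_image] at h3
  omega
end

section
/- The graph G admits a super-stable matching if and only if S_∅ = ∅, i.e., if and only if there is no hospital critical with respect to (B_∅, μ_∅). -/
open Set

namespace SMInstance

variable {V : Type*} (I : SMInstance V)

theorem incid_doctor_iff {e : V × V} (he : e ∈ I.E) {d : V} (hd : d ∈ I.Dset) :
    incid d e ↔ e.1 = d := by
  refine ⟨?_, Or.inl⟩
  rintro (h | h)
  · exact h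
  · exact absurd (h ▸ (I.edge_mem e he).2) (Set.disjoint_left.1 I.disj hd)

theorem incid_hospital_iff {e : V × V} (he : e ∈ I.E) {h : V} (hh : h ∈ I.Hset) :
    incid h e ↔ e.2 = h := by
  refine ⟨?_, Or.inr⟩
  rintro (h' | h')
  · exact absurd hh (Set.disjoint_left.1 I.disj (h' ▸ (I.edge_mem e he).1))
  · exact h'

theorem mem_ChD_iff {F : Set (V × V)} (hF : F ⊆ I.E) {e : V × V} :
    e ∈ I.ChD F ↔ e ∈ F ∧ ∀ f ∈ F, f.1 = e.1 → I.pref e.1 e f := by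
  simp only [ChD, Chd, Set.mem_iUnion, Set.mem_ofPred_eq, exists_prop]
  constructor
  · rintro ⟨d, hd, he, hde, h⟩
    obtain rfl := (I.incid_doctor_iff (hF he) hd).1 hde
    exact ⟨he, fun f hf hfe => h f hf (Or.inl hfe)⟩
  · rintro ⟨he, h⟩
    have hd := (I.edge_mem e (hF he)).1
    exact ⟨e.1, hd, he, Or.inl rfl,
      fun f hf hfe => h f hf ((I.incid_doctor_iff (hF hf) hd).1 hfe)⟩

theorem mem_ChH_iff {F : Set (V × V)} (hF : F ⊆ I.E) {e : V × V} :
    e ∈ I.ChH F ↔ e ∈ F ∧ ∀ f ∈ F, f.2 = e.2 → f ≠ e → I.sprefer e.2 e f := by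
  simp only [ChH, Chh, Set.mem_iUnion, Set.mem_ofPred_eq, exists_prop]
  constructor
  · rintro ⟨h, hh, he, hhe, H⟩
    obtain rfl := (I.incid_hospital_iff (hF he) hh).1 hhe
    exact ⟨he, fun f hf hfe => H f hf (Or.inr hfe)⟩
  · rintro ⟨he, H⟩
    have hh := (I.edge_mem e (hF he)).2
    exact ⟨e.2, hh, he, Or.inr rfl,
      fun f hf hfe => H f hf ((I.incid_hospital_iff (hF hf) hh).1 hfe)⟩

theorem ChD_subset {F : Set (V × V)} (hF : F ⊆ I.E) : I.ChD F ⊆ F :=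
  fun _ he => ((I.mem_ChD_iff hF).1 he).1

theorem R_subset (X : Set V) : ∀ t, I.R X t ⊆ I.E
  | 0 => fun _ he => he.1
  | t + 1 => Set.union_subset (R_subset X t) fun _ he =>
      (I.ChD_subset Set.sdiff_subset he.1).1

theorem R_mono (X : Set V) : Monotone (I.R X) :=
  monotone_nat_of_le_succ fun _ => Set.subset_union_left

theorem exists_R_eq_B [Finite V] (X : Set V) :
    ∃ t, I.R X t = I.B X ∧ I.R X (t + 1) = I.B X := by
  have hne : {t : ℕ | 1 ≤ t ∧ I.R X t = I.R X (t - 1)}.Nonempty := by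
    obtain ⟨n, hn⟩ := WellFoundedGT.monotone_chain_condition ⟨I.R X, I.R_mono X⟩
    exact ⟨n + 1, by omega, (hn (n + 1) (by omega)).symm⟩
  obtain ⟨h1, h2⟩ := Nat.sInf_mem hne
  refine ⟨I.kX X - 1, h2.symm, ?_⟩
  rw [show I.kX X - 1 + 1 = I.kX X from Nat.sub_add_cancel h1]
  rfl

theorem B_subset (X : Set V) : I.B X ⊆ I.E := I.R_subset X _

/-- At the end of the preprocessing no doctor's choice is rejected. -/
theorem ChD_subset_ChH_B [Finite V] (X : Set V) :
    I.ChD (I.E \ I.B X) ⊆ I.ChH (I.ChD (I.E \ I.B X) ∪ I.B X) := by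
  obtain ⟨t, h1, h2⟩ := I.exists_R_eq_B X
  intro e he
  by_contra hne
  have hmem : e ∈ I.R X (t + 1) := by
    rw [R, h1]
    exact Or.inr ⟨he, fun h => hne h.1⟩
  rw [h2] at hmem
  exact (I.ChD_subset Set.sdiff_subset he).2 hmem

theorem ChD_union_subset {R : Set (V × V)} (hR : R ⊆ I.E) : I.ChD (I.E \ R) ∪ R ⊆ I.E :=
  Set.union_subset ((I.ChD_subset Set.sdiff_subset).trans Set.sdiff_subset) hR

/-- A hospital strictly prefers an edge proposed after the preprocessing to every other edge
proposed to it or rejected by it. -/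
theorem sprefer_of_mem_ChD_B [Finite V] {X : Set V} {e f : V × V}
    (he : e ∈ I.ChD (I.E \ I.B X)) (hf : f ∈ I.ChD (I.E \ I.B X) ∪ I.B X)
    (hfe : f.2 = e.2) (hne : f ≠ e) : I.sprefer e.2 e f :=
  ((I.mem_ChH_iff (I.ChD_union_subset (I.B_subset X))).1 (I.ChD_subset_ChH_B X he)).2 f hf hfe hne

variable {I}

theorem superStable.exists_sprefer {μ : Set (V × V)} (hμ : I.superStable ∅ μ) {e : V × V}
    (he : e ∈ I.E) (heμ : e ∉ μ) (hd : ∀ f ∈ μ, f.1 = e.1 → I.pref e.1 e f) :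
    ∃ f ∈ μ, f.2 = e.2 ∧ ¬ I.pref e.2 e f := by
  by_contra! H
  obtain ⟨hD, hH⟩ := I.edge_mem e he
  exact hμ.2 e ⟨he, by simp, by simp, heμ,
    fun f hf hfe => hd f hf ((I.incid_doctor_iff (hμ.1.1 hf) hD).1 hfe),
    fun f hf hfe => H f hf ((I.incid_hospital_iff (hμ.1.1 hf) hH).1 hfe)⟩

theorem pref_of_mem_ChD_union {R μ : Set (V × V)} (hμE : μ ⊆ I.E) (hdisj : ∀ e ∈ μ, e ∉ R)
    (hR : ∀ e ∈ R, ∀ f ∈ μ, f.1 = e.1 → I.pref e.1 e f) :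
    ∀ e ∈ I.ChD (I.E \ R) ∪ R, ∀ f ∈ μ, f.1 = e.1 → I.pref e.1 e f := by
  rintro e (he | he) f hf hfe
  · exact ((I.mem_ChD_iff Set.sdiff_subset).1 he).2 f ⟨hμE hf, hdisj f hf⟩ hfe
  · exact hR e he f hf hfe

/-- The preprocessing never rejects an edge of a super-stable matching, and every doctor weakly
prefers each rejected edge to the partner in that matching. -/
theorem superStable.R_invariant {μ : Set (V × V)} (hμ : I.superStable ∅ μ) (t : ℕ) :
    (∀ e ∈ μ, e ∉ I.R ∅ t) ∧
      ∀ e ∈ I.R ∅ t, ∀ f ∈ μ, f.1 = e.1 → I.pref e.1 e f := by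
  induction t with
  | zero => simp [R]
  | succ t ih =>
    obtain ⟨hdisj, hpref⟩ := ih
    have hP := pref_of_mem_ChD_union hμ.1.1 hdisj hpref
    have hsub := I.ChD_union_subset (I.R_subset ∅ t)
    refine ⟨?_, ?_⟩
    · rintro e he (heR | ⟨heP, heQ⟩)
      · exact hdisj e he heR
      · refine heQ ⟨(I.mem_ChH_iff hsub).2 ⟨Or.inl heP, fun f hf hfe hne => ?_⟩, heP⟩
        have hfμ : f ∉ μ := fun h => hne (hμ.1.injOn_snd h he hfe)
        obtain ⟨g, hg, hgf, hnp⟩ := hμ.exists_sprefer (hsub hf) hfμ (hP f hf)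
        obtain rfl := hμ.1.injOn_snd hg he (hgf.trans hfe)
        rw [hfe] at hnp
        exact ⟨(I.pref_total g.2 g (hμ.1.1 he) f (hsub hf) (Or.inr rfl)
          (Or.inr hfe)).resolve_right hnp, hnp⟩
    · rintro e (he | he)
      · exact hpref e he
      · exact hP e (Or.inl he.1)

theorem superStable.exists_snd_eq {μ : Set (V × V)} (hμ : I.superStable ∅ μ) {e : V × V}
    (he : e ∈ I.ChD (I.E \ I.B ∅) ∪ I.B ∅) : ∃ f ∈ μ, f.2 = e.2 := by
  by_cases heμ : e ∈ μ
  · exact ⟨e, heμ, rfl⟩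
  obtain ⟨hdisj, hpref⟩ := hμ.R_invariant (I.kX ∅)
  obtain ⟨f, hf, hfe, -⟩ := hμ.exists_sprefer (I.ChD_union_subset (I.B_subset ∅) he) heμ
    (pref_of_mem_ChD_union hμ.1.1 hdisj hpref e he)
  exact ⟨f, hf, hfe⟩

theorem superStable.not_critical [Finite V] {σ μ : Set (V × V)} (hσ : I.superStable ∅ σ)
    (hμ : I.isMatching ∅ μ) (hμCh : μ ⊆ I.ChD (I.E \ I.B ∅))
    (hμcov : ∀ d ∈ I.docs (I.E \ I.B ∅), ∃ e ∈ μ, incid d e) (h : V) :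
    ¬ I.critical ∅ μ h := by
  rintro ⟨hh, hunm, hex⟩
  have hfst : Prod.fst '' σ ⊆ Prod.fst '' μ := by
    rintro _ ⟨e, he, rfl⟩
    have hD := (I.edge_mem e (hσ.1.1 he)).1
    obtain ⟨f, hf, hfe⟩ := hμcov e.1
      ⟨hD, e, ⟨hσ.1.1 he, (hσ.R_invariant (I.kX ∅)).1 e he⟩, Or.inl rfl⟩
    exact ⟨f, hf, (I.incid_doctor_iff (hμ.1 hf) hD).1 hfe⟩
  have hsnd : Prod.snd '' μ ⊂ Prod.snd '' σ := by
    refine (Set.ssubset_iff_of_subset ?_).2 ⟨h, ?_, ?_⟩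
    · rintro _ ⟨e, he, rfl⟩
      exact hσ.exists_snd_eq (Or.inl (hμCh he))
    · obtain ⟨e, he, hhe⟩ : ∃ e ∈ I.ChD (I.E \ I.B ∅) ∪ I.B ∅, incid h e := by
        rcases hex with ⟨e, he, hhe⟩ | ⟨e, he, hhe⟩
        · exact ⟨e, Or.inr he, hhe⟩
        · exact ⟨e, Or.inl he, hhe⟩
      obtain rfl := (I.incid_hospital_iff (I.ChD_union_subset (I.B_subset ∅) he) hh).1 hhe
      exact hσ.exists_snd_eq he
    · rintro ⟨e, he, rfl⟩
      exact hunm e he (Or.inr rfl)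
  have h1 := Set.ncard_le_ncard hfst
  have h2 := Set.ncard_lt_ncard hsnd
  rw [hσ.1.injOn_fst.ncard_image, hμ.injOn_fst.ncard_image] at h1
  rw [hσ.1.injOn_snd.ncard_image, hμ.injOn_snd.ncard_image] at h2
  omega

theorem superStable_of_forall_not_critical [Finite V] {μ : Set (V × V)}
    (hμ : I.isMatching ∅ μ) (hμCh : μ ⊆ I.ChD (I.E \ I.B ∅))
    (hμcov : ∀ d ∈ I.docs (I.E \ I.B ∅), ∃ e ∈ μ, incid d e)
    (hcrit : ∀ h, ¬ I.critical ∅ μ h) : I.superStable ∅ μ := by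
  refine ⟨hμ, ?_⟩
  rintro e ⟨heE, -, -, heμ, hd, hh⟩
  obtain ⟨hD, hH⟩ := I.edge_mem e heE
  have he : e ∈ I.ChD (I.E \ I.B ∅) ∪ I.B ∅ := by
    by_cases heB : e ∈ I.B ∅
    · exact Or.inr heB
    refine Or.inl ((I.mem_ChD_iff Set.sdiff_subset).2 ⟨⟨heE, heB⟩, fun g hg hge => ?_⟩)
    obtain ⟨f, hf, hfe⟩ := hμcov e.1 ⟨hD, e, ⟨heE, heB⟩, Or.inl rfl⟩
    have hfe' := (I.incid_doctor_iff (hμ.1 hf) hD).1 hfe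
    have hfg := ((I.mem_ChD_iff Set.sdiff_subset).1 (hμCh hf)).2 g hg (hge.trans hfe'.symm)
    rw [hfe'] at hfg
    exact I.pref_trans e.1 e heE f (hμ.1 hf) g hg.1 (Or.inl rfl) hfe (Or.inl hge)
      (hd f hf hfe) hfg
  obtain ⟨f, hf, hfe⟩ : ∃ f ∈ μ, incid e.2 f := by
    by_contra! H
    refine hcrit e.2 ⟨hH, H, ?_⟩
    rcases he with he | he
    · exact Or.inr ⟨e, he, Or.inr rfl⟩
    · exact Or.inl ⟨e, he, Or.inr rfl⟩
  have hfe' := (I.incid_hospital_iff (hμ.1 hf) hH).1 hfe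
  have hs := I.sprefer_of_mem_ChD_B (hμCh hf) he hfe'.symm fun h => heμ (h ▸ hf)
  rw [hfe'] at hs
  exact hs.2 (hh f hf hfe)

end SMInstance

/-- The graph `G` admits a super-stable matching if and only if `S_∅ = ∅`,
i.e., iff no hospital is critical with respect to `(B_∅, μ_∅)`. -/
theorem statement12 {V : Type*} [Fintype V] (I : SMInstance V)
    (μ0 : Set (V × V)) (hμ0 : I.isMatching (∅ : Set V) μ0)
    (hμ0Ch : μ0 ⊆ I.ChD (I.E \ I.B (∅ : Set V)))
    (hμ0cov : ∀ d ∈ I.docs (I.E \ I.B (∅ : Set V)), ∃ e ∈ μ0, incid d e) :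
    I.feasible (∅ : Set V) ↔ {h | I.critical (∅ : Set V) μ0 h} = ∅ := by
  rw [Set.eq_empty_iff_forall_notMem]
  constructor
  · rintro ⟨σ, hσ⟩ h
    exact hσ.not_critical hμ0 hμ0Ch hμ0cov h
  · exact fun hcrit =>
      ⟨μ0, SMInstance.superStable_of_forall_not_critical hμ0 hμ0Ch hμ0cov hcrit⟩
end
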